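/- arXiv:2309.11185 — 2 statements merged into one kernel-verified Lean document; each statement's English description precedes it below -/
import Mathlib

section
/- (Expression of u in terms of V.) For every τ ∈ (0,1], every even integer N ≥ 2 and every t ∈ ℝ: δ(t)·u(t) = a(t)·V(t) + b(t)·V′(t) + c(t)·V″(t), where δ(t) = −N·τ²·(1+τ)⁵·d(t). Equivalently, u(t) = (a(t)V(t) + b(t)V′(t) + c(t)V″(t))/δ(t) at every t with d(t) ≠ 0. -/
open Real MeasureTheory Finset

/-- The rescaled (monic-type) Hermite polynomials `C_k` with parameter `τ`:
`C_0(x) = 1`, `C_1(x) = x`, `C_{k+1}(x) = x·C_k(x) − k·τ·C_{k−1}(x)`. -/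
noncomputable def CH (τ : ℝ) : ℕ → ℝ → ℝ
  | 0 => fun _ => 1
  | 1 => fun x => x
  | (k+2) => fun x => x * CH τ (k+1) x - ((k : ℝ) + 1) * τ * CH τ k x

/-- The elliptic GinUE part `R_N^{(1)}` of the real-eigenvalue density. -/
noncomputable def R1 (τ : ℝ) (N : ℕ) (x : ℝ) : ℝ :=
  (Real.exp (-x^2/(1+τ)) / Real.sqrt (2*Real.pi)) *
    ∑ k ∈ Finset.range (N-1), (CH τ k x)^2 / (Nat.factorial k : ℝ)

/-- The correction part `R_N^{(2)}` of the real-eigenvalue density. -/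
noncomputable def R2 (τ : ℝ) (N : ℕ) (x : ℝ) : ℝ :=
  (1/((1+τ) * (Nat.factorial (N-2) : ℝ))) * (Real.exp (-x^2/(2*(1+τ))) / Real.sqrt (2*Real.pi)) *
    CH τ (N-1) x * (∫ u in (0:ℝ)..x, Real.exp (-u^2/(2*(1+τ))) * CH τ (N-2) u)

/-- The density `R_N` of real eigenvalues of the elliptic GinOE. -/
noncomputable def Rd (τ : ℝ) (N : ℕ) (x : ℝ) : ℝ := R1 τ N x + R2 τ N x

/-- The moment generating function of real eigenvalues of the elliptic GinOE. -/
noncomputable def MGF (τ : ℝ) (N : ℕ) (t : ℝ) : ℝ := ∫ x : ℝ, Real.exp (t*x) * Rd τ N x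

/-- The `p`-th spectral moment of real eigenvalues of the elliptic GinOE. -/
noncomputable def Mom (τ : ℝ) (N : ℕ) (p : ℕ) : ℝ := ∫ x : ℝ, x^p * Rd τ N x

/-- The elliptic GinUE part `u` of the moment generating function. -/
noncomputable def uF (τ : ℝ) (N : ℕ) (t : ℝ) : ℝ := ∫ x : ℝ, Real.exp (t*x) * R1 τ N x

/-- The part `v` of the moment generating function coming from `R_N^{(2)}`. -/
noncomputable def vF (τ : ℝ) (N : ℕ) (t : ℝ) : ℝ := ∫ x : ℝ, Real.exp (t*x) * R2 τ N x

/-- The auxiliary function `V(t)` built from the moment generating function `M`. -/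
noncomputable def VF (τ : ℝ) (N : ℕ) (t : ℝ) : ℝ :=
  ((1-τ)/2) * iteratedDeriv 3 (MGF τ N) t
  - ((1+τ)*(τ^2-3*τ+1)/2) * t * iteratedDeriv 2 (MGF τ N) t
  - ((1-τ^2)/2) * (2*τ*(1+τ)*t^2 + ((N:ℝ)-1)*(1+τ) + 2-τ) * deriv (MGF τ N) t
  - (τ*(1+τ)^2/2) * (τ*(1+τ)*t^2 + ((N:ℝ)-1)*(1+τ) + 3-2*τ) * t * MGF τ N t

/-- The function `a(t)`. -/
noncomputable def aP (τ Nr t : ℝ) : ℝ :=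
  -2*τ^2*(1+τ)^3*(1+2*τ)*t^6 + 4*τ*(1+τ)^2*(1+8*τ-5*τ*(1-τ^2)*Nr)*t^4
  + 8*(1-τ^2)*(1-3*τ-30*τ^2+(1-τ^2)*(3+4*τ+4*τ^2)*Nr+2*(1-τ^2)^2*Nr^2)*t^2
  + 32*(1-τ)^2*(1+6*τ+2*(1-τ^2)*Nr)

/-- The function `b(t)`. -/
noncomputable def bP (τ Nr t : ℝ) : ℝ :=
  -2*τ*(1+τ)^2*(1-τ-6*τ^2)*t^5 + 4*(1-τ^2)*((1-2*τ)*(1+7*τ)+2*(1-τ)^3*(1+τ)*Nr)*t^3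
  - 32*(1-τ)^2*(1+6*τ+2*(1-τ^2)*Nr)*t

/-- The function `c(t)`. -/
noncomputable def cP (τ Nr t : ℝ) : ℝ :=
  4*τ*(1-τ^2)*(1+2*τ)*t^4 - 8*(1-τ)^2*(1+6*τ+2*Nr*(1-τ^2))*t^2

/-- The function `d(t)`. -/
noncomputable def dP (τ Nr t : ℝ) : ℝ :=
  τ*(1+τ)*(2+τ)*(1+2*τ)*t^5 - 2*(1-τ)*(4+17*τ+6*τ^2+2*Nr*(1-τ^2))*t^3

/-- A continuous function dominated by a centred Gaussian. -/
def GaussDecay (g : ℝ → ℝ) : Prop :=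
  Continuous g ∧ ∃ ε > 0, ∃ K, ∀ x, |g x| ≤ K * Real.exp (-ε * x ^ 2)

/-- The integral of `exp (t * x) * x ^ k * g x` over the line. -/
noncomputable def expMoment (g : ℝ → ℝ) (k : ℕ) (t : ℝ) : ℝ :=
  ∫ x : ℝ, Real.exp (t * x) * (x ^ k * g x)

namespace GaussDecay

variable {f g h : ℝ → ℝ}

theorem continuous (hg : GaussDecay g) : Continuous g := hg.1

theorem exists_bound (hg : GaussDecay g) : ∃ K, ∀ x, |g x| ≤ K := by
  obtain ⟨-, ε, hε, K, hK⟩ := hg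
  have hK0 : 0 ≤ K := by simpa using (abs_nonneg _).trans (hK 0)
  refine ⟨K, fun x => (hK x).trans (mul_le_of_le_one_right hK0 ?_)⟩
  exact Real.exp_le_one_iff.2 (by nlinarith [sq_nonneg x])

theorem mul_bounded (hg : GaussDecay g) (hf : Continuous f) {B : ℝ} (hB : ∀ x, |f x| ≤ B) :
    GaussDecay fun x => g x * f x := by
  obtain ⟨hc, ε, hε, K, hK⟩ := hg
  refine ⟨hc.mul hf, ε, hε, K * B, fun x => ?_⟩
  calc |g x * f x| = |g x| * |f x| := abs_mul _ _
    _ ≤ (K * Real.exp (-ε * x ^ 2)) * B :=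
      mul_le_mul (hK x) (hB x) (abs_nonneg _) ((abs_nonneg _).trans (hK x))
    _ = K * B * Real.exp (-ε * x ^ 2) := by ring

theorem mul (hg : GaussDecay g) (hf : GaussDecay f) : GaussDecay fun x => g x * f x :=
  let ⟨_, hB⟩ := hf.exists_bound
  hg.mul_bounded hf.continuous hB

theorem const_mul (hg : GaussDecay g) (c : ℝ) : GaussDecay fun x => c * g x := by
  simpa only [mul_comm c] using hg.mul_bounded (f := fun _ => c) continuous_const fun _ => le_rfl

theorem add (hg : GaussDecay g) (hf : GaussDecay f) : GaussDecay fun x => g x + f x := by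
  obtain ⟨hc, ε, hε, K, hK⟩ := hg
  obtain ⟨hc', ε', hε', K', hK'⟩ := hf
  have hK0 : 0 ≤ K := by simpa using (abs_nonneg _).trans (hK 0)
  have hK0' : 0 ≤ K' := by simpa using (abs_nonneg _).trans (hK' 0)
  refine ⟨hc.add hc', min ε ε', lt_min hε hε', K + K', fun x => ?_⟩
  have h₁ : Real.exp (-ε * x ^ 2) ≤ Real.exp (-min ε ε' * x ^ 2) :=
    Real.exp_le_exp.2 (by nlinarith [sq_nonneg x, min_le_left ε ε'])
  have h₂ : Real.exp (-ε' * x ^ 2) ≤ Real.exp (-min ε ε' * x ^ 2) :=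
    Real.exp_le_exp.2 (by nlinarith [sq_nonneg x, min_le_right ε ε'])
  calc |g x + f x| ≤ |g x| + |f x| := abs_add_le _ _
    _ ≤ K * Real.exp (-ε * x ^ 2) + K' * Real.exp (-ε' * x ^ 2) := add_le_add (hK x) (hK' x)
    _ ≤ K * Real.exp (-min ε ε' * x ^ 2) + K' * Real.exp (-min ε ε' * x ^ 2) := by gcongr
    _ = (K + K') * Real.exp (-min ε ε' * x ^ 2) := by ring

theorem sum {ι : Type*} (s : Finset ι) {F : ι → ℝ → ℝ} (hF : ∀ i ∈ s, GaussDecay (F i)) :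
    GaussDecay fun x => ∑ i ∈ s, F i x := by
  classical
  induction s using Finset.induction_on with
  | empty => exact ⟨by simpa using continuous_const, 1, one_pos, 0, by simp⟩
  | insert i s his ih =>
    simp only [Finset.sum_insert his]
    exact (hF i (by simp)).add (ih fun j hj => hF j (by simp [hj]))

/-- Multiplication by a linear exponential costs only part of the Gaussian decay. -/
theorem exp_abs_mul (hg : GaussDecay g) (a : ℝ) :
    GaussDecay fun x => Real.exp (a * |x|) * g x := by
  obtain ⟨hc, ε, hε, K, hK⟩ := hg
  have hK0 : 0 ≤ K := by simpa using (abs_nonneg _).trans (hK 0)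
  refine ⟨by fun_prop, ε / 2, by positivity, K * Real.exp (a ^ 2 / (2 * ε)), fun x => ?_⟩
  have key : a * |x| + -ε * x ^ 2 ≤ a ^ 2 / (2 * ε) + -(ε / 2) * x ^ 2 := by
    have : a ^ 2 / (2 * ε) + -(ε / 2) * x ^ 2 - (a * |x| + -ε * x ^ 2)
        = (a - ε * |x|) ^ 2 / (2 * ε) := by
      rw [← sq_abs x]; field_simp; ring
    have : 0 ≤ (a - ε * |x|) ^ 2 / (2 * ε) := by positivity
    linarith
  calc |Real.exp (a * |x|) * g x| = Real.exp (a * |x|) * |g x| := by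
        rw [abs_mul, abs_of_pos (Real.exp_pos _)]
    _ ≤ Real.exp (a * |x|) * (K * Real.exp (-ε * x ^ 2)) := by gcongr; exact hK x
    _ = K * Real.exp (a * |x| + -ε * x ^ 2) := by rw [Real.exp_add]; ring
    _ ≤ K * Real.exp (a ^ 2 / (2 * ε) + -(ε / 2) * x ^ 2) := by gcongr
    _ = _ := by rw [Real.exp_add]; ring

theorem of_abs_le (hg : GaussDecay g) (hf : Continuous f) (h : ∀ x, |f x| ≤ |g x|) :
    GaussDecay f := by
  obtain ⟨-, ε, hε, K, hK⟩ := hg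
  exact ⟨hf, ε, hε, K, fun x => (h x).trans (hK x)⟩

theorem exp_mul (hg : GaussDecay g) (t : ℝ) : GaussDecay fun x => Real.exp (t * x) * g x := by
  have := hg.continuous
  refine (hg.exp_abs_mul |t|).of_abs_le (by fun_prop) fun x => ?_
  rw [abs_mul, abs_mul, abs_of_pos (Real.exp_pos _), abs_of_pos (Real.exp_pos _), ← abs_mul]
  gcongr
  exact le_abs_self _

theorem id_mul (hg : GaussDecay g) : GaussDecay fun x => x * g x := by
  have := hg.continuous
  refine (hg.exp_abs_mul 1).of_abs_le (by fun_prop) fun x => ?_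
  rw [abs_mul, abs_mul, abs_of_pos (Real.exp_pos _), one_mul]
  gcongr
  linarith [Real.add_one_le_exp |x|]

theorem pow_mul (hg : GaussDecay g) (k : ℕ) : GaussDecay fun x => x ^ k * g x := by
  induction k with
  | zero => simpa using hg
  | succ k ih => simpa only [pow_succ', mul_assoc] using ih.id_mul

theorem integrable (hg : GaussDecay g) : Integrable g := by
  obtain ⟨hc, ε, hε, K, hK⟩ := hg
  exact ((integrable_exp_neg_mul_sq hε).const_mul K).mono' hc.aestronglyMeasurable
    (Filter.Eventually.of_forall hK)

theorem integrable_exp_mul_pow_mul (hg : GaussDecay g) (k : ℕ) (t : ℝ) :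
    Integrable fun x => Real.exp (t * x) * (x ^ k * g x) :=
  ((hg.pow_mul k).exp_mul t).integrable

theorem hasDerivAt_expMoment (hg : GaussDecay g) (k : ℕ) (t : ℝ) :
    HasDerivAt (expMoment g k) (expMoment g (k + 1) t) t := by
  have hc := hg.continuous
  refine (hasDerivAt_integral_of_dominated_loc_of_deriv_le
    (F := fun t x => Real.exp (t * x) * (x ^ k * g x))
    (F' := fun t x => Real.exp (t * x) * (x ^ (k + 1) * g x))
    (bound := fun x => |Real.exp ((|t| + 1) * |x|) * (x ^ (k + 1) * g x)|)
    (Metric.ball_mem_nhds t one_pos) ?_ ?_ ?_ ?_ ?_ ?_).2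
  · exact Filter.Eventually.of_forall fun s =>
      (hg.integrable_exp_mul_pow_mul k s).aestronglyMeasurable
  · exact hg.integrable_exp_mul_pow_mul k t
  · exact (hg.integrable_exp_mul_pow_mul (k + 1) t).aestronglyMeasurable
  · refine Filter.Eventually.of_forall fun x s hs => ?_
    rw [Real.norm_eq_abs, abs_mul, abs_mul (Real.exp _), abs_of_pos (Real.exp_pos _),
      abs_of_pos (Real.exp_pos _)]
    refine mul_le_mul_of_nonneg_right (Real.exp_le_exp.2 ?_) (abs_nonneg _)
    refine (le_abs_self _).trans ?_
    rw [abs_mul]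
    gcongr
    have : |s - t| < 1 := by simpa [Real.dist_eq] using hs
    linarith [abs_sub_abs_le_abs_sub s t]
  · exact ((hg.pow_mul (k + 1)).exp_abs_mul _).integrable.abs
  · refine Filter.Eventually.of_forall fun x s _ => ?_
    have : HasDerivAt (fun s => Real.exp (s * x)) (Real.exp (s * x) * (1 * x)) s :=
      ((hasDerivAt_id s).mul_const x).exp
    exact (this.mul_const (x ^ k * g x)).congr_deriv (by ring)

theorem iteratedDeriv_expMoment (hg : GaussDecay g) (j k : ℕ) :
    iteratedDeriv j (expMoment g k) = expMoment g (k + j) := by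
  induction j with
  | zero => simp
  | succ j ih =>
    rw [iteratedDeriv_succ, ih]
    exact funext fun t => (hg.hasDerivAt_expMoment (k + j) t).deriv

theorem expMoment_add (hg : GaussDecay g) (hf : GaussDecay f) (k : ℕ) (t : ℝ) :
    expMoment (fun x => g x + f x) k t = expMoment g k t + expMoment f k t := by
  unfold expMoment
  rw [← integral_add (hg.integrable_exp_mul_pow_mul k t) (hf.integrable_exp_mul_pow_mul k t)]
  exact integral_congr_ae (Filter.Eventually.of_forall fun x => by simp only; ring)

/-- Integration by parts for exponential moments, for `g' = a f + b h + c x g`. -/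
theorem expMoment_by_parts (hg : GaussDecay g) (hf : GaussDecay f) (hh : GaussDecay h)
    {a b c : ℝ} (hd : ∀ x, HasDerivAt g (a * f x + b * h x + c * (x * g x)) x) (k : ℕ) (t : ℝ) :
    t * expMoment g k t + k * expMoment g (k - 1) t + a * expMoment f k t
      + b * expMoment h k t + c * expMoment g (k + 1) t = 0 := by
  have ig := (hg.integrable_exp_mul_pow_mul k t).const_mul t
  have ig' := (hg.integrable_exp_mul_pow_mul (k - 1) t).const_mul k
  have iF := (hf.integrable_exp_mul_pow_mul k t).const_mul a
  have ih := (hh.integrable_exp_mul_pow_mul k t).const_mul b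
  have igs := (hg.integrable_exp_mul_pow_mul (k + 1) t).const_mul c
  have key : ∫ x : ℝ, t * (Real.exp (t * x) * (x ^ k * g x))
      + k * (Real.exp (t * x) * (x ^ (k - 1) * g x)) + a * (Real.exp (t * x) * (x ^ k * f x))
      + b * (Real.exp (t * x) * (x ^ k * h x))
      + c * (Real.exp (t * x) * (x ^ (k + 1) * g x)) = 0 := by
    refine integral_eq_zero_of_hasDerivAt_of_integrable (fun x => ?_)
      ((((ig.add ig').add iF).add ih).add igs) (hg.integrable_exp_mul_pow_mul k t)
    have he : HasDerivAt (fun x => Real.exp (t * x)) (Real.exp (t * x) * (t * 1)) x :=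
      ((hasDerivAt_id x).const_mul t).exp
    exact (he.mul ((hasDerivAt_pow k x).mul (hd x))).congr_deriv (by
      simp only [Pi.mul_apply, pow_succ]; ring)
  rw [integral_add, integral_add, integral_add, integral_add ig ig'] at key
  · simpa only [expMoment, integral_const_mul] using key
  exacts [ig.add ig', iF, (ig.add ig').add iF, ih, ((ig.add ig').add iF).add ih, igs]

end GaussDecay

theorem hasDerivAt_CH_succ (τ : ℝ) (k : ℕ) (x : ℝ) :
    HasDerivAt (CH τ (k + 1)) ((k + 1) * CH τ k x) x := by
  induction k using Nat.twoStepInduction with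
  | zero => simpa [CH] using hasDerivAt_id' x
  | one =>
    have h : HasDerivAt (fun y : ℝ => y * y - (((0 : ℕ) : ℝ) + 1) * τ * 1) (1 * x + x * 1) x :=
      ((hasDerivAt_id x).mul (hasDerivAt_id x)).sub_const _
    exact h.congr_deriv (by simp [CH]; ring)
  | more k ih₀ ih₁ =>
    have h := ((hasDerivAt_id x).mul ih₁).sub (ih₀.const_mul ((((k + 1 : ℕ) : ℝ) + 1) * τ))
    refine HasDerivAt.congr_deriv (f := CH τ (k + 2 + 1)) h ?_
    simp only [CH, id]
    push_cast
    ring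

theorem mul_deriv_CH (τ : ℝ) (k : ℕ) (x : ℝ) :
    HasDerivAt (fun y => τ * CH τ k y) (x * CH τ k x - CH τ (k + 1) x) x := by
  cases k with
  | zero => simpa [CH] using hasDerivAt_const x τ
  | succ k =>
    refine ((hasDerivAt_CH_succ τ k x).const_mul τ).congr_deriv ?_
    simp only [CH]
    ring

theorem hasDerivAt_CH {τ : ℝ} (hτ : τ ≠ 0) (k : ℕ) (x : ℝ) :
    HasDerivAt (CH τ k) ((x * CH τ k x - CH τ (k + 1) x) / τ) x := by
  simpa [hτ] using (mul_deriv_CH τ k x).div_const τ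

/-- The polynomials `CH` multiplied by the Gaussian weight of variance `1 + τ`. -/
noncomputable def weightedCH (τ : ℝ) (k : ℕ) (x : ℝ) : ℝ :=
  Real.exp (-x ^ 2 / (2 * (1 + τ))) * CH τ k x

theorem gaussDecay_weightedCH {τ : ℝ} (hτ : 0 < 1 + τ) (k : ℕ) :
    GaussDecay (weightedCH τ k) := by
  have h₀ : GaussDecay (weightedCH τ 0) := by
    refine ⟨by unfold weightedCH; simp only [CH]; fun_prop, 1 / (2 * (1 + τ)), by positivity, 1,
      fun x => le_of_eq ?_⟩
    simp only [weightedCH, CH, mul_one, one_mul, abs_of_pos (Real.exp_pos _)]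
    congr 1
    ring
  induction k using Nat.twoStepInduction with
  | zero => exact h₀
  | one =>
    convert h₀.id_mul using 2 with x
    simp only [weightedCH, CH]
    ring
  | more k ih₀ ih₁ =>
    convert ih₁.id_mul.add (ih₀.const_mul (-((k + 1) * τ))) using 2 with x
    simp only [weightedCH, CH]
    ring

theorem hasDerivAt_gaussWeight (τ x : ℝ) :
    HasDerivAt (fun y : ℝ => Real.exp (-y ^ 2 / (2 * (1 + τ))))
      (-(x / (1 + τ)) * Real.exp (-x ^ 2 / (2 * (1 + τ)))) x := by
  refine (((hasDerivAt_pow 2 x).neg.div_const (2 * (1 + τ))).exp).congr_deriv ?_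
  have : (2 : ℝ) * x / (2 * (1 + τ)) = x / (1 + τ) := mul_div_mul_left _ _ two_ne_zero
  rw [← this]
  simp
  ring

theorem hasDerivAt_weightedCH_succ (τ : ℝ) (k : ℕ) (x : ℝ) :
    HasDerivAt (weightedCH τ (k + 1))
      ((k + 1) * weightedCH τ k x - x / (1 + τ) * weightedCH τ (k + 1) x) x :=
  ((hasDerivAt_gaussWeight τ x).mul (hasDerivAt_CH_succ τ k x)).congr_deriv
    (by simp only [weightedCH]; ring)

theorem hasDerivAt_weightedCH {τ : ℝ} (hτ : 0 < τ) (k : ℕ) (x : ℝ) :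
    HasDerivAt (weightedCH τ k)
      (x / (τ * (1 + τ)) * weightedCH τ k x - weightedCH τ (k + 1) x / τ) x := by
  refine ((hasDerivAt_gaussWeight τ x).mul (hasDerivAt_CH hτ.ne' k x)).congr_deriv ?_
  simp only [weightedCH]
  have : 1 + τ ≠ 0 := by positivity
  field_simp
  ring

/-- The antiderivative of `weightedCH` vanishing at the origin. -/
noncomputable def weightedCHPrimitive (τ : ℝ) (k : ℕ) (x : ℝ) : ℝ :=
  ∫ u in (0 : ℝ)..x, weightedCH τ k u

theorem hasDerivAt_weightedCHPrimitive {τ : ℝ} (hτ : 0 < 1 + τ) (k : ℕ) (x : ℝ) :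
    HasDerivAt (weightedCHPrimitive τ k) (weightedCH τ k x) x :=
  intervalIntegral.integral_hasDerivAt_right
    ((gaussDecay_weightedCH hτ k).continuous.intervalIntegrable _ _)
    ((gaussDecay_weightedCH hτ k).continuous.stronglyMeasurableAtFilter _ _)
    (gaussDecay_weightedCH hτ k).continuous.continuousAt

theorem GaussDecay.mul_weightedCHPrimitive {τ : ℝ} (hτ : 0 < 1 + τ) {g : ℝ → ℝ}
    (hg : GaussDecay g) (k : ℕ) : GaussDecay fun x => g x * weightedCHPrimitive τ k x := by
  refine hg.mul_bounded (B := ∫ u, |weightedCH τ k u|) ?_ fun x => ?_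
  · exact continuous_iff_continuousAt.2 fun x => (hasDerivAt_weightedCHPrimitive hτ k x).continuousAt
  · refine (intervalIntegral.norm_integral_le_integral_norm_uIoc (f := weightedCH τ k)).trans ?_
    exact setIntegral_le_integral (gaussDecay_weightedCH hτ k).integrable.abs
      (Filter.Eventually.of_forall fun u => abs_nonneg _)

/-- The common prefactor of `R2` and of the derivative of `R1`. -/
noncomputable def densityConst (τ : ℝ) (n : ℕ) : ℝ :=
  1 / ((1 + τ) * (Nat.factorial n : ℝ) * Real.sqrt (2 * Real.pi))

theorem R2_eq (τ : ℝ) (n : ℕ) (x : ℝ) :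
    R2 τ (n + 2) x
      = densityConst τ n * (weightedCH τ (n + 1) x * weightedCHPrimitive τ n x) := by
  simp only [R2, densityConst, weightedCHPrimitive, weightedCH, Nat.add_sub_cancel,
    show n + 2 - 1 = n + 1 from rfl, one_div, mul_inv]
  ring

theorem R1_eq (τ : ℝ) (n : ℕ) (x : ℝ) :
    R1 τ (n + 2) x = ∑ k ∈ Finset.range (n + 1),
      1 / (Real.sqrt (2 * Real.pi) * (Nat.factorial k : ℝ)) *
        (weightedCH τ k x * weightedCH τ k x) := by
  have h : Real.exp (-x ^ 2 / (1 + τ))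
      = Real.exp (-x ^ 2 / (2 * (1 + τ))) * Real.exp (-x ^ 2 / (2 * (1 + τ))) := by
    rw [← Real.exp_add, ← mul_div_mul_left (-x ^ 2) (1 + τ) two_ne_zero]
    congr 1
    ring
  simp only [R1, show n + 2 - 1 = n + 1 from rfl, h, Finset.mul_sum, weightedCH, one_div, mul_inv]
  exact Finset.sum_congr rfl fun k _ => by ring

theorem gaussDecay_R1 {τ : ℝ} (hτ : 0 < 1 + τ) (n : ℕ) : GaussDecay (R1 τ (n + 2)) := by
  rw [funext (R1_eq τ n)]
  exact GaussDecay.sum _ fun k _ =>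
    ((gaussDecay_weightedCH hτ k).mul (gaussDecay_weightedCH hτ k)).const_mul _

theorem gaussDecay_R2 {τ : ℝ} (hτ : 0 < 1 + τ) (n : ℕ) : GaussDecay (R2 τ (n + 2)) := by
  rw [funext (R2_eq τ n)]
  exact ((gaussDecay_weightedCH hτ (n + 1)).mul_weightedCHPrimitive hτ n).const_mul _

theorem hasDerivAt_R1 {τ : ℝ} (hτ : 0 < 1 + τ) (n : ℕ) (x : ℝ) :
    HasDerivAt (R1 τ (n + 2))
      (-2 * (densityConst τ n * (weightedCH τ (n + 1) x * weightedCH τ n x))) x := by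
  rw [funext (R1_eq τ n)]
  have hsq : Real.sqrt (2 * Real.pi) ≠ 0 := by positivity
  induction n with
  | zero =>
    have h₀ : HasDerivAt (weightedCH τ 0) (-(x / (1 + τ)) * weightedCH τ 0 x) x := by
      simpa [funext fun y => show weightedCH τ 0 y = _ from mul_one _] using
        hasDerivAt_gaussWeight τ x
    simp only [zero_add, Finset.sum_range_one]
    refine ((h₀.mul h₀).const_mul _).congr_deriv ?_
    simp only [densityConst, weightedCH, CH, Nat.factorial_zero, Nat.cast_one]
    field_simp
    ring
  | succ n ih =>
    have h := ((hasDerivAt_weightedCH_succ τ n x).mul (hasDerivAt_weightedCH_succ τ n x)).const_mul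
      (1 / (Real.sqrt (2 * Real.pi) * (Nat.factorial (n + 1) : ℝ)))
    simp only [Finset.sum_range_succ _ (n + 1)]
    refine (ih.add h).congr_deriv ?_
    have hf : (Nat.factorial n : ℝ) ≠ 0 := by positivity
    simp only [densityConst, weightedCH, CH, Nat.factorial_succ]
    push_cast
    field_simp
    ring

/-- The quadratic density built from the `i`-th and `j`-th weighted polynomials. -/
noncomputable def pairDensity (τ : ℝ) (n i j : ℕ) (x : ℝ) : ℝ :=
  densityConst τ n * (weightedCH τ i x * weightedCH τ j x)

/-- The density built from the `i`-th weighted polynomial and the primitive of the `n`-th one. -/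
noncomputable def primitiveDensity (τ : ℝ) (n i : ℕ) (x : ℝ) : ℝ :=
  densityConst τ n * (weightedCH τ i x * weightedCHPrimitive τ n x)

theorem gaussDecay_pairDensity {τ : ℝ} (hτ : 0 < 1 + τ) (n i j : ℕ) :
    GaussDecay (pairDensity τ n i j) :=
  ((gaussDecay_weightedCH hτ i).mul (gaussDecay_weightedCH hτ j)).const_mul _

theorem gaussDecay_primitiveDensity {τ : ℝ} (hτ : 0 < 1 + τ) (n i : ℕ) :
    GaussDecay (primitiveDensity τ n i) :=
  ((gaussDecay_weightedCH hτ i).mul_weightedCHPrimitive hτ n).const_mul _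

theorem expMoment_R1_recurrence {τ : ℝ} (hτ : 0 < τ) (n k : ℕ) (t : ℝ) :
    t * expMoment (R1 τ (n + 2)) k t + k * expMoment (R1 τ (n + 2)) (k - 1) t
      = 2 * expMoment (pairDensity τ n (n + 1) n) k t := by
  have hs : 0 < 1 + τ := by positivity
  have hX := gaussDecay_pairDensity hs n (n + 1) n
  have := (gaussDecay_R1 hs n).expMoment_by_parts hX hX (a := -2) (b := 0) (c := 0)
    (fun x => (hasDerivAt_R1 hs n x).congr_deriv (by simp only [pairDensity]; ring)) k t
  linear_combination this

theorem expMoment_pairDensity_succ_succ_recurrence {τ : ℝ} (hτ : 0 < τ) (n k : ℕ) (t : ℝ) :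
    2 * expMoment (pairDensity τ n (n + 1) (n + 1)) (k + 1) t
      = (1 + τ) * (t * expMoment (pairDensity τ n (n + 1) (n + 1)) k t
        + k * expMoment (pairDensity τ n (n + 1) (n + 1)) (k - 1) t
        + 2 * (n + 1) * expMoment (pairDensity τ n (n + 1) n) k t) := by
  have hs : 0 < 1 + τ := by positivity
  have hX := gaussDecay_pairDensity hs n (n + 1) n
  have hp := hasDerivAt_weightedCH_succ τ n
  have := (gaussDecay_pairDensity hs n (n + 1) (n + 1)).expMoment_by_parts hX hX
    (a := 2 * (n + 1)) (b := 0) (c := -2 / (1 + τ))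
    (fun x => (((hp x).mul (hp x)).const_mul _).congr_deriv
      (by simp only [pairDensity]; ring)) k t
  field_simp at this
  linear_combination -this

theorem expMoment_pairDensity_succ_self_recurrence {τ : ℝ} (hτ : 0 < τ) (n k : ℕ) (t : ℝ) :
    (1 - τ) * expMoment (pairDensity τ n (n + 1) n) (k + 1) t
      = (1 + τ) * expMoment (pairDensity τ n (n + 1) (n + 1)) k t
        - τ * (1 + τ) * (t * expMoment (pairDensity τ n (n + 1) n) k t
          + k * expMoment (pairDensity τ n (n + 1) n) (k - 1) t
          + (n + 1) * expMoment (pairDensity τ n n n) k t) := by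
  have hs : 0 < 1 + τ := by positivity
  have hp := hasDerivAt_weightedCH_succ τ n
  have hq := hasDerivAt_weightedCH hτ n
  have := (gaussDecay_pairDensity hs n (n + 1) n).expMoment_by_parts
    (gaussDecay_pairDensity hs n n n) (gaussDecay_pairDensity hs n (n + 1) (n + 1))
    (a := n + 1) (b := -1 / τ) (c := 1 / (τ * (1 + τ)) - 1 / (1 + τ))
    (fun x => (((hp x).mul (hq x)).const_mul _).congr_deriv
      (by simp only [pairDensity]; ring)) k t
  field_simp at this
  linear_combination this

theorem expMoment_pairDensity_self_self_recurrence {τ : ℝ} (hτ : 0 < τ) (n k : ℕ) (t : ℝ) :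
    2 * expMoment (pairDensity τ n n n) (k + 1) t
      = 2 * (1 + τ) * expMoment (pairDensity τ n (n + 1) n) k t
        - τ * (1 + τ) * (t * expMoment (pairDensity τ n n n) k t
          + k * expMoment (pairDensity τ n n n) (k - 1) t) := by
  have hs : 0 < 1 + τ := by positivity
  have hq := hasDerivAt_weightedCH hτ n
  have hX := gaussDecay_pairDensity hs n (n + 1) n
  have := (gaussDecay_pairDensity hs n n n).expMoment_by_parts hX hX
    (a := -2 / τ) (b := 0) (c := 2 / (τ * (1 + τ)))
    (fun x => (((hq x).mul (hq x)).const_mul _).congr_deriv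
      (by simp only [pairDensity]; ring)) k t
  field_simp at this
  linear_combination this

theorem expMoment_primitiveDensity_succ_recurrence {τ : ℝ} (hτ : 0 < τ) (n k : ℕ) (t : ℝ) :
    expMoment (primitiveDensity τ n (n + 1)) (k + 1) t
      = (1 + τ) * (t * expMoment (primitiveDensity τ n (n + 1)) k t
        + k * expMoment (primitiveDensity τ n (n + 1)) (k - 1) t
        + (n + 1) * expMoment (primitiveDensity τ n n) k t
        + expMoment (pairDensity τ n (n + 1) n) k t) := by
  have hs : 0 < 1 + τ := by positivity
  have hp := hasDerivAt_weightedCH_succ τ n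
  have hF := hasDerivAt_weightedCHPrimitive hs n
  have := (gaussDecay_primitiveDensity hs n (n + 1)).expMoment_by_parts
    (gaussDecay_primitiveDensity hs n n) (gaussDecay_pairDensity hs n (n + 1) n)
    (a := n + 1) (b := 1) (c := -1 / (1 + τ))
    (fun x => (((hp x).mul (hF x)).const_mul _).congr_deriv
      (by simp only [pairDensity, primitiveDensity]; ring)) k t
  field_simp at this
  linear_combination -this

theorem expMoment_primitiveDensity_self_recurrence {τ : ℝ} (hτ : 0 < τ) (n k : ℕ) (t : ℝ) :
    expMoment (primitiveDensity τ n n) (k + 1) t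
      = (1 + τ) * expMoment (primitiveDensity τ n (n + 1)) k t
        - τ * (1 + τ) * (t * expMoment (primitiveDensity τ n n) k t
          + k * expMoment (primitiveDensity τ n n) (k - 1) t
          + expMoment (pairDensity τ n n n) k t) := by
  have hs : 0 < 1 + τ := by positivity
  have hq := hasDerivAt_weightedCH hτ n
  have hF := hasDerivAt_weightedCHPrimitive hs n
  have := (gaussDecay_primitiveDensity hs n n).expMoment_by_parts
    (gaussDecay_primitiveDensity hs n (n + 1)) (gaussDecay_pairDensity hs n n n)
    (a := -1 / τ) (b := 1) (c := 1 / (τ * (1 + τ)))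
    (fun x => (((hq x).mul (hF x)).const_mul _).congr_deriv
      (by simp only [pairDensity, primitiveDensity]; ring)) k t
  field_simp at this
  linear_combination this

/-- Differential equations for `u`, expressed on the sequence of its derivatives, obtained by
eliminating the auxiliary sequences `X`, `P`, `Q`; the last two equations are the derivative of
the first one divided by `t`, and its derivative. -/
theorem relations_of_recurrences {T n t : ℝ} {u X P Q : ℕ → ℝ}
    (hu : ∀ k : ℕ, t * u k + k * u (k - 1) = 2 * X k)
    (hP : ∀ k : ℕ, 2 * P (k + 1) = (1 + T) * (t * P k + k * P (k - 1) + 2 * (n + 1) * X k))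
    (hX : ∀ k : ℕ, (1 - T) * X (k + 1)
      = (1 + T) * P k - T * (1 + T) * (t * X k + k * X (k - 1) + (n + 1) * Q k))
    (hQ : ∀ k : ℕ, 2 * Q (k + 1)
      = 2 * (1 + T) * X k - T * (1 + T) * (t * Q k + k * Q (k - 1))) :
    (4 * (1 - T) * t ^ 2 * u 3 + (8 * (1 - T) * t - 2 * (1 + T) * (1 - 4 * T + T ^ 2) * t ^ 3) * u 2
      + (-8 * (1 - T) + (1 + T) * (-8 - 4 * n + 20 * T + 4 * T ^ 2 * n) * t ^ 2
        - 3 * T * (1 - T) * (1 + T) ^ 2 * t ^ 4) * u 1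
      + (T * (1 + T) ^ 2 * (-9 - 4 * n + T - 4 * T * n) * t ^ 3
        - T ^ 2 * (1 + T) ^ 3 * t ^ 5) * u 0 = 0) ∧
    (4 * (1 - T) * t * u 4 + (16 * (1 - T) - 2 * (1 + T) * (1 - 4 * T + T ^ 2) * t ^ 2) * u 3
      + ((1 + T) * (-14 - 4 * n + 44 * T - 6 * T ^ 2 + 4 * T ^ 2 * n) * t
        - 3 * T * (1 - T) * (1 + T) ^ 2 * t ^ 3) * u 2
      + (2 * (1 + T) * (-8 - 4 * n + 20 * T + 4 * T ^ 2 * n)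
        + T * (1 + T) ^ 2 * (-21 - 4 * n + 13 * T - 4 * T * n) * t ^ 2
        - T ^ 2 * (1 + T) ^ 3 * t ^ 4) * u 1
      + (3 * T * (1 + T) ^ 2 * (-9 - 4 * n + T - 4 * T * n) * t
        - 5 * T ^ 2 * (1 + T) ^ 3 * t ^ 3) * u 0 = 0) ∧
    (4 * (1 - T) * t * u 5 + (20 * (1 - T) - 2 * (1 + T) * (1 - 4 * T + T ^ 2) * t ^ 2) * u 4
      + ((1 + T) * (-18 - 4 * n + 60 * T - 10 * T ^ 2 + 4 * T ^ 2 * n) * t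
        - 3 * T * (1 - T) * (1 + T) ^ 2 * t ^ 3) * u 3
      + ((1 + T) * (-30 - 12 * n + 84 * T - 6 * T ^ 2 + 12 * T ^ 2 * n)
        + T * (1 + T) ^ 2 * (-30 - 4 * n + 22 * T - 4 * T * n) * t ^ 2
        - T ^ 2 * (1 + T) ^ 3 * t ^ 4) * u 2
      + (T * (1 + T) ^ 2 * (-69 - 20 * n + 29 * T - 20 * T * n) * t
        - 9 * T ^ 2 * (1 + T) ^ 3 * t ^ 3) * u 1
      + (3 * T * (1 + T) ^ 2 * (-9 - 4 * n + T - 4 * T * n)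
        - 15 * T ^ 2 * (1 + T) ^ 3 * t ^ 2) * u 0 = 0) := by
  have hX' : ∀ k : ℕ, X k = (t * u k + k * u (k - 1)) / 2 := fun k => by
    linear_combination -hu k / 2
  have hP' : ∀ k : ℕ, P (k + 1)
      = (1 + T) * (t * P k + k * P (k - 1) + 2 * (n + 1) * X k) / 2 := fun k => by
    linear_combination hP k / 2
  have hQ' : ∀ k : ℕ, Q (k + 1)
      = (2 * (1 + T) * X k - T * (1 + T) * (t * Q k + k * Q (k - 1))) / 2 := fun k => by
    linear_combination hQ k / 2
  have r₀ := hX 0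
  have r₁ := hX 1
  have r₂ := hX 2
  have r₃ := hX 3
  have r₄ := hX 4
  have P₁ := hP' 0
  have P₂ := hP' 1
  have P₃ := hP' 2
  have P₄ := hP' 3
  have Q₁ := hQ' 0
  have Q₂ := hQ' 1
  have Q₃ := hQ' 2
  have Q₄ := hQ' 3
  norm_num [hX'] at r₀ r₁ r₂ r₃ r₄ P₁ P₂ P₃ P₄ Q₁ Q₂ Q₃ Q₄
  simp only [P₁, P₂, P₃, P₄, Q₁, Q₂, Q₃, Q₄] at r₁ r₂ r₃ r₄
  clear P₁ P₂ P₃ P₄ Q₁ Q₂ Q₃ Q₄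
  have H₀ := congrArg₂ (fun a b => a - (1 + T) / 2 * t * b) r₁ r₀
  have H₁ := congrArg₂ (fun a b => a - (1 + T) / 2 * b) r₂
    (congrArg₂ (fun a b => t * a + b) r₁ r₀)
  have H₂ := congrArg₂ (fun a b => a - (1 + T) / 2 * b) r₃
    (congrArg₂ (fun a b => t * a + 2 * b) r₂ r₁)
  have H₃ := congrArg₂ (fun a b => a - (1 + T) / 2 * b) r₄
    (congrArg₂ (fun a b => t * a + 3 * b) r₃ r₂)
  refine ⟨?_, ?_, ?_⟩
  · linear_combination 8 * (t * H₁ - H₀ + (1 + T) * T / 2 * t ^ 2 * H₀)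
  · linear_combination 8 * (H₂ + (1 + T) * T * H₀ + (1 + T) * T / 2 * t * H₁)
  · linear_combination 8 * (H₃ + (1 + T) * T * H₁ + (1 + T) * T / 2 * (t * H₂ + H₁))

/-- Elimination of the auxiliary sequences from the combination of derivatives defining `VF`. -/
theorem combination_of_recurrences {T n t : ℝ} {u X P Q Y Z : ℕ → ℝ}
    (hu : ∀ k : ℕ, t * u k + k * u (k - 1) = 2 * X k)
    (hP : ∀ k : ℕ, 2 * P (k + 1) = (1 + T) * (t * P k + k * P (k - 1) + 2 * (n + 1) * X k))
    (hX : ∀ k : ℕ, (1 - T) * X (k + 1)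
      = (1 + T) * P k - T * (1 + T) * (t * X k + k * X (k - 1) + (n + 1) * Q k))
    (hQ : ∀ k : ℕ, 2 * Q (k + 1)
      = 2 * (1 + T) * X k - T * (1 + T) * (t * Q k + k * Q (k - 1)))
    (hY : ∀ k : ℕ, Y (k + 1)
      = (1 + T) * (t * Y k + k * Y (k - 1) + (n + 1) * Z k + X k))
    (hZ : ∀ k : ℕ, Z (k + 1)
      = (1 + T) * Y k - T * (1 + T) * (t * Z k + k * Z (k - 1) + Q k)) :
    (1 - T) / 2 * (u 3 + Y 3) - (1 + T) * (T ^ 2 - 3 * T + 1) / 2 * t * (u 2 + Y 2)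
      - (1 - T ^ 2) / 2 * (2 * T * (1 + T) * t ^ 2 + (n + 1) * (1 + T) + 2 - T) * (u 1 + Y 1)
      - T * (1 + T) ^ 2 / 2 * (T * (1 + T) * t ^ 2 + (n + 1) * (1 + T) + 3 - 2 * T) * t
        * (u 0 + Y 0)
    = (1 - T) / 2 * u 3 - (1 + T) * (1 - 4 * T + T ^ 2) / 4 * (t * u 2)
      - (1 - T ^ 2) / 8 * ((4 * (2 + n + T + n * T) + 3 * T * (1 + T) * t ^ 2) * u 1)
      - T * (1 + T) ^ 2 / 8
        * (((9 + 4 * n + 5 * T + 4 * n * T) * t + T * (1 + T) * t ^ 3) * u 0) := by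
  have hX' : ∀ k : ℕ, X k = (t * u k + k * u (k - 1)) / 2 := fun k => by
    linear_combination -hu k / 2
  have P₁ : P 1 = (1 + T) * (t * P 0 + 2 * (n + 1) * X 0) / 2 := by
    have := hP 0
    norm_num at this
    linear_combination this / 2
  have Q₁ : Q 1 = (2 * (1 + T) * X 0 - T * (1 + T) * (t * Q 0)) / 2 := by
    have := hQ 0
    norm_num at this
    linear_combination this / 2
  have r₀ := hX 0
  have r₁ := hX 1
  have Y₁ := hY 0
  have Y₂ := hY 1
  have Y₃ := hY 2
  have Z₁ := hZ 0
  have Z₂ := hZ 1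
  norm_num [hX', P₁, Q₁] at r₀ r₁ Y₁ Y₂ Y₃ Z₁ Z₂
  simp only [Y₃, Y₂, Z₂, Y₁, Z₁]
  linear_combination (1 + T) * T / 2 * (r₁ - (1 + T) / 2 * t * r₀)

theorem u_eq_combination_of_relations {T n t : ℝ} {u : ℕ → ℝ} {W W' W'' : ℝ}
    (hW : W = (1 - T) / 2 * u 3 - (1 + T) * (1 - 4 * T + T ^ 2) / 4 * (t * u 2)
      - (1 - T ^ 2) / 8 * ((4 * (2 + n + T + n * T) + 3 * T * (1 + T) * t ^ 2) * u 1)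
      - T * (1 + T) ^ 2 / 8
        * (((9 + 4 * n + 5 * T + 4 * n * T) * t + T * (1 + T) * t ^ 3) * u 0))
    (hW' : W' = (1 - T) / 2 * u 4 - (1 + T) * (1 - 4 * T + T ^ 2) / 4 * (u 2 + t * u 3)
      - (1 - T ^ 2) / 8 * (6 * T * (1 + T) * (t * u 1)
        + (4 * (2 + n + T + n * T) + 3 * T * (1 + T) * t ^ 2) * u 2)
      - T * (1 + T) ^ 2 / 8
        * ((9 + 4 * n + 5 * T + 4 * n * T + 3 * T * (1 + T) * t ^ 2) * u 0
          + ((9 + 4 * n + 5 * T + 4 * n * T) * t + T * (1 + T) * t ^ 3) * u 1))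
    (hW'' : W'' = (1 - T) / 2 * u 5
      - (1 + T) * (1 - 4 * T + T ^ 2) / 4 * (2 * u 3 + t * u 4)
      - (1 - T ^ 2) / 8 * (6 * T * (1 + T) * (u 1 + 2 * t * u 2)
        + (4 * (2 + n + T + n * T) + 3 * T * (1 + T) * t ^ 2) * u 3)
      - T * (1 + T) ^ 2 / 8
        * (6 * T * (1 + T) * t * u 0
          + 2 * (9 + 4 * n + 5 * T + 4 * n * T + 3 * T * (1 + T) * t ^ 2) * u 1
          + ((9 + 4 * n + 5 * T + 4 * n * T) * t + T * (1 + T) * t ^ 3) * u 2))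
    (hK : 4 * (1 - T) * t ^ 2 * u 3 + (8 * (1 - T) * t - 2 * (1 + T) * (1 - 4 * T + T ^ 2) * t ^ 3) * u 2
      + (-8 * (1 - T) + (1 + T) * (-8 - 4 * n + 20 * T + 4 * T ^ 2 * n) * t ^ 2
        - 3 * T * (1 - T) * (1 + T) ^ 2 * t ^ 4) * u 1
      + (T * (1 + T) ^ 2 * (-9 - 4 * n + T - 4 * T * n) * t ^ 3
        - T ^ 2 * (1 + T) ^ 3 * t ^ 5) * u 0 = 0)
    (hJ : 4 * (1 - T) * t * u 4 + (16 * (1 - T) - 2 * (1 + T) * (1 - 4 * T + T ^ 2) * t ^ 2) * u 3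
      + ((1 + T) * (-14 - 4 * n + 44 * T - 6 * T ^ 2 + 4 * T ^ 2 * n) * t
        - 3 * T * (1 - T) * (1 + T) ^ 2 * t ^ 3) * u 2
      + (2 * (1 + T) * (-8 - 4 * n + 20 * T + 4 * T ^ 2 * n)
        + T * (1 + T) ^ 2 * (-21 - 4 * n + 13 * T - 4 * T * n) * t ^ 2
        - T ^ 2 * (1 + T) ^ 3 * t ^ 4) * u 1
      + (3 * T * (1 + T) ^ 2 * (-9 - 4 * n + T - 4 * T * n) * t
        - 5 * T ^ 2 * (1 + T) ^ 3 * t ^ 3) * u 0 = 0)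
    (hJ' : 4 * (1 - T) * t * u 5 + (20 * (1 - T) - 2 * (1 + T) * (1 - 4 * T + T ^ 2) * t ^ 2) * u 4
      + ((1 + T) * (-18 - 4 * n + 60 * T - 10 * T ^ 2 + 4 * T ^ 2 * n) * t
        - 3 * T * (1 - T) * (1 + T) ^ 2 * t ^ 3) * u 3
      + ((1 + T) * (-30 - 12 * n + 84 * T - 6 * T ^ 2 + 12 * T ^ 2 * n)
        + T * (1 + T) ^ 2 * (-30 - 4 * n + 22 * T - 4 * T * n) * t ^ 2
        - T ^ 2 * (1 + T) ^ 3 * t ^ 4) * u 2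
      + (T * (1 + T) ^ 2 * (-69 - 20 * n + 29 * T - 20 * T * n) * t
        - 9 * T ^ 2 * (1 + T) ^ 3 * t ^ 3) * u 1
      + (3 * T * (1 + T) ^ 2 * (-9 - 4 * n + T - 4 * T * n)
        - 15 * T ^ 2 * (1 + T) ^ 3 * t ^ 2) * u 0 = 0) :
    (-(n + 2) * T ^ 2 * (1 + T) ^ 5 * dP T (n + 2) t) * u 0
      = aP T (n + 2) t * W + bP T (n + 2) t * W' + cP T (n + 2) t * W'' := by
  rw [hW, hW', hW'', aP, bP, cP, dP]
  linear_combination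
    (1 - T) / 2 * ((1 - T) * (10 + 4 * n + 12 * T - 8 * T ^ 2 - 4 * T ^ 2 * n)
      - T * (1 + T) * (1 + 2 * T) * t ^ 2) * (t * hJ' + hJ)
    + ((1 - T) ^ 2 * (-10 - 4 * n - 12 * T + 8 * T ^ 2 + 4 * T ^ 2 * n)
      + (1 - T) * (1 + T) / 2 * (-5 - 2 * n + (9 + 4 * n) * T + 26 * T ^ 2
        - (8 + 4 * n) * T ^ 3 + (4 + 2 * n) * T ^ 4) * t ^ 2
      + T * (1 + T) ^ 2 / 4 * (1 - T - 6 * T ^ 2) * t ^ 4) * hJ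
    + ((1 - T) * (1 + T) * (-10 - 9 * n - 2 * n ^ 2 - (27 + 12 * n) * T
        + (17 * n + 4 * n ^ 2) * T ^ 2 + (24 + 12 * n) * T ^ 3 - (8 + 8 * n + 2 * n ^ 2) * T ^ 4)
      + T * (1 + T) ^ 2 / 2 * (-2 + (6 + 5 * n) * T + 12 * T ^ 2 - (10 + 5 * n) * T ^ 3) * t ^ 2
      + T ^ 2 * (1 + T) ^ 3 / 4 * (1 + 2 * T) * t ^ 4) * hK

/-- Two successive derivatives of the differential operator giving `VF` in terms of `uF`. -/
theorem hasDerivAt_combination {U : ℕ → ℝ → ℝ}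
    (hU : ∀ k t, HasDerivAt (U k) (U (k + 1) t) t) (c₃ c₂ c₁ c₀ a₁ b₁ a₀ b₀ t : ℝ) :
    HasDerivAt (fun t => c₃ * U 3 t - c₂ * (t * U 2 t) - c₁ * ((a₁ + b₁ * t ^ 2) * U 1 t)
        - c₀ * ((a₀ * t + b₀ * t ^ 3) * U 0 t))
      (c₃ * U 4 t - c₂ * (U 2 t + t * U 3 t)
        - c₁ * (2 * b₁ * (t * U 1 t) + (a₁ + b₁ * t ^ 2) * U 2 t)
        - c₀ * ((a₀ + 3 * b₀ * t ^ 2) * U 0 t + (a₀ * t + b₀ * t ^ 3) * U 1 t)) t ∧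
    HasDerivAt (fun t => c₃ * U 4 t - c₂ * (U 2 t + t * U 3 t)
        - c₁ * (2 * b₁ * (t * U 1 t) + (a₁ + b₁ * t ^ 2) * U 2 t)
        - c₀ * ((a₀ + 3 * b₀ * t ^ 2) * U 0 t + (a₀ * t + b₀ * t ^ 3) * U 1 t))
      (c₃ * U 5 t - c₂ * (2 * U 3 t + t * U 4 t)
        - c₁ * (2 * b₁ * (U 1 t + 2 * t * U 2 t) + (a₁ + b₁ * t ^ 2) * U 3 t)
        - c₀ * (6 * b₀ * t * U 0 t + 2 * (a₀ + 3 * b₀ * t ^ 2) * U 1 t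
          + (a₀ * t + b₀ * t ^ 3) * U 2 t)) t := by
  have ht := hasDerivAt_id' t
  have hsq (a b : ℝ) : HasDerivAt (fun t => a + b * t ^ 2) (2 * b * t) t :=
    (((hasDerivAt_pow 2 t).const_mul b).const_add a).congr_deriv (by norm_num; ring)
  have hcub : HasDerivAt (fun t => a₀ * t + b₀ * t ^ 3) (a₀ + 3 * b₀ * t ^ 2) t :=
    ((ht.const_mul a₀).add ((hasDerivAt_pow 3 t).const_mul b₀)).congr_deriv (by norm_num; ring)
  constructor
  · exact (((((hU 3 t).const_mul c₃).sub ((ht.mul (hU 2 t)).const_mul c₂)).sub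
      (((hsq a₁ b₁).mul (hU 1 t)).const_mul c₁)).sub
      ((hcub.mul (hU 0 t)).const_mul c₀)).congr_deriv (by ring)
  · exact (((((hU 4 t).const_mul c₃).sub (((hU 2 t).add (ht.mul (hU 3 t))).const_mul c₂)).sub
      ((((ht.mul (hU 1 t)).const_mul (2 * b₁)).add ((hsq a₁ b₁).mul (hU 2 t))).const_mul c₁)).sub
      ((((hsq a₀ (3 * b₀)).mul (hU 0 t)).add (hcub.mul (hU 1 t))).const_mul c₀)).congr_deriv
      (by ring)

theorem VF_eq {τ : ℝ} (hτ : 0 < τ) (n : ℕ) (t : ℝ) :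
    VF τ (n + 2) t = (1 - τ) / 2 * expMoment (R1 τ (n + 2)) 3 t
      - (1 + τ) * (1 - 4 * τ + τ ^ 2) / 4 * (t * expMoment (R1 τ (n + 2)) 2 t)
      - (1 - τ ^ 2) / 8 * ((4 * (2 + n + τ + n * τ) + 3 * τ * (1 + τ) * t ^ 2)
        * expMoment (R1 τ (n + 2)) 1 t)
      - τ * (1 + τ) ^ 2 / 8 * (((9 + 4 * n + 5 * τ + 4 * n * τ) * t + τ * (1 + τ) * t ^ 3)
        * expMoment (R1 τ (n + 2)) 0 t) := by
  have hs : 0 < 1 + τ := by positivity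
  have hR : GaussDecay (Rd τ (n + 2)) := (gaussDecay_R1 hs n).add (gaussDecay_R2 hs n)
  have hM : MGF τ (n + 2) = expMoment (Rd τ (n + 2)) 0 := by
    funext t
    simp [MGF, expMoment]
  have hsplit (k : ℕ) : expMoment (Rd τ (n + 2)) k t
      = expMoment (R1 τ (n + 2)) k t + expMoment (primitiveDensity τ n (n + 1)) k t := by
    rw [← show R2 τ (n + 2) = primitiveDensity τ n (n + 1) from funext (R2_eq τ n)]
    exact (gaussDecay_R1 hs n).expMoment_add (gaussDecay_R2 hs n) k t
  have key := combination_of_recurrences (n := (n : ℝ))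
    (u := fun k => expMoment (R1 τ (n + 2)) k t)
    (X := fun k => expMoment (pairDensity τ n (n + 1) n) k t)
    (P := fun k => expMoment (pairDensity τ n (n + 1) (n + 1)) k t)
    (Q := fun k => expMoment (pairDensity τ n n n) k t)
    (Y := fun k => expMoment (primitiveDensity τ n (n + 1)) k t)
    (Z := fun k => expMoment (primitiveDensity τ n n) k t)
    (fun k => expMoment_R1_recurrence hτ n k t)
    (fun k => expMoment_pairDensity_succ_succ_recurrence hτ n k t)
    (fun k => expMoment_pairDensity_succ_self_recurrence hτ n k t)
    (fun k => expMoment_pairDensity_self_self_recurrence hτ n k t)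
    (fun k => expMoment_primitiveDensity_succ_recurrence hτ n k t)
    (fun k => expMoment_primitiveDensity_self_recurrence hτ n k t)
  rw [VF, ← iteratedDeriv_one, hM, hR.iteratedDeriv_expMoment, hR.iteratedDeriv_expMoment,
    hR.iteratedDeriv_expMoment]
  simp only [zero_add, hsplit]
  rw [← key]
  push_cast
  ring

/-- **Theorem (Expression of `u` in terms of `V`).**
For every `τ ∈ (0,1]`, every even integer `N ≥ 2` and every `t ∈ ℝ`,
`δ(t)·u(t) = a(t)·V(t) + b(t)·V′(t) + c(t)·V″(t)` where `δ(t) = −N·τ²·(1+τ)⁵·d(t)`. -/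
theorem u_in_terms_of_V (τ : ℝ) (hτ : τ ∈ Set.Ioc (0:ℝ) 1)
    (N : ℕ) (hNeven : Even N) (hN2 : 2 ≤ N) (t : ℝ) :
    (-(N:ℝ)*τ^2*(1+τ)^5*dP τ (N:ℝ) t) * uF τ N t
      = aP τ (N:ℝ) t * VF τ N t + bP τ (N:ℝ) t * deriv (VF τ N) t
        + cP τ (N:ℝ) t * iteratedDeriv 2 (VF τ N) t := by
  obtain ⟨n, rfl⟩ : ∃ n, N = n + 2 := ⟨N - 2, by omega⟩
  have hs : 0 < 1 + τ := by linarith [hτ.1]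
  have hd := fun t => hasDerivAt_combination
    (fun k t => (gaussDecay_R1 hs n).hasDerivAt_expMoment k t) ((1 - τ) / 2)
    ((1 + τ) * (1 - 4 * τ + τ ^ 2) / 4) ((1 - τ ^ 2) / 8) (τ * (1 + τ) ^ 2 / 8)
    (4 * (2 + n + τ + n * τ)) (3 * τ * (1 + τ)) (9 + 4 * n + 5 * τ + 4 * n * τ) (τ * (1 + τ)) t
  have hV₁ := fun t =>
    ((hd t).1.congr_of_eventuallyEq (Filter.Eventually.of_forall (VF_eq hτ.1 n))).deriv
  have hV₂ := ((hd t).2.congr_of_eventuallyEq (Filter.Eventually.of_forall hV₁)).deriv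
  have hV : iteratedDeriv 2 (VF τ (n + 2)) t = deriv (deriv (VF τ (n + 2))) t := by
    rw [iteratedDeriv_succ, iteratedDeriv_one]
  have hu : uF τ (n + 2) t = expMoment (R1 τ (n + 2)) 0 t := by simp [uF, expMoment]
  obtain ⟨hK, hJ, hJ'⟩ := relations_of_recurrences (n := (n : ℝ))
    (u := fun k => expMoment (R1 τ (n + 2)) k t)
    (X := fun k => expMoment (pairDensity τ n (n + 1) n) k t)
    (P := fun k => expMoment (pairDensity τ n (n + 1) (n + 1)) k t)
    (Q := fun k => expMoment (pairDensity τ n n n) k t)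
    (fun k => expMoment_R1_recurrence hτ.1 n k t)
    (fun k => expMoment_pairDensity_succ_succ_recurrence hτ.1 n k t)
    (fun k => expMoment_pairDensity_succ_self_recurrence hτ.1 n k t)
    (fun k => expMoment_pairDensity_self_self_recurrence hτ.1 n k t)
  rw [hu, show ((n + 2 : ℕ) : ℝ) = (n : ℝ) + 2 by push_cast; ring]
  exact u_eq_combination_of_relations (u := fun k => expMoment (R1 τ (n + 2)) k t)
    (VF_eq hτ.1 n t) ((hV₁ t).trans (by ring)) ((hV.trans hV₂).trans (by ring)) hK hJ hJ'
end

section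
/- (Third-order differential equation for σ.) For every τ ∈ [0,1] and every even integer N ≥ 2, the function σ satisfies, for all t ∈ ℝ: (4(1−τ)/(1+τ))·σ‴(t) = 2(1−4τ+τ²)·t·σ″(t) + [3τ(1−τ²)t² + 4((N−1)(1−τ²) + 1−2τ)]·σ′(t) + [τ²(1+τ)t² + 4(N−1)τ(1+τ) + τ(5−τ)]·(1+τ)·t·σ(t). -/
open Real MeasureTheory Finset

/-- The function `σ(t) = ∫_ℝ e^{tx}·C_{N−1}(x)²·e^{−x²/(1+τ)} dx`
(the paper's `σ` up to a nonzero constant factor). -/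
noncomputable def sigmaF (τ : ℝ) (N : ℕ) (t : ℝ) : ℝ :=
  ∫ x : ℝ, Real.exp (t*x) * (CH τ (N-1) x)^2 * Real.exp (-x^2/(1+τ))

open Polynomial

/-- The polynomial whose evaluation is `CH τ k`. -/
noncomputable def CHPoly (τ : ℝ) : ℕ → ℝ[X]
  | 0 => 1
  | 1 => X
  | (k+2) => X * CHPoly τ (k+1) - C (((k : ℝ) + 1) * τ) * CHPoly τ k

theorem CHPoly_eval (τ : ℝ) (x : ℝ) : ∀ k, (CHPoly τ k).eval x = CH τ k x
  | 0 => by simp [CHPoly, CH]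
  | 1 => by simp [CHPoly, CH]
  | (k+2) => by
    simp only [CHPoly, CH, eval_sub, eval_mul, eval_X, eval_C, CHPoly_eval τ x (k+1),
      CHPoly_eval τ x k]

theorem CHPoly_derivative_succ (τ : ℝ) :
    ∀ k, derivative (CHPoly τ (k+1)) = C ((k : ℝ) + 1) * CHPoly τ k
  | 0 => by simp [CHPoly]
  | 1 => by simp [CHPoly]; ring
  | (k+2) => by
    rw [CHPoly, derivative_sub, derivative_mul, derivative_C_mul, CHPoly_derivative_succ τ (k+1),
      CHPoly_derivative_succ τ k, derivative_X, CHPoly]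
    simp only [Nat.cast_add, Nat.cast_one, Nat.cast_ofNat, map_add, map_mul, map_one, map_ofNat,
      map_natCast]
    ring

/-- The Hermite differential equation. -/
theorem CHPoly_hermite_ode (τ : ℝ) :
    ∀ k : ℕ, C τ * derivative (derivative (CHPoly τ k)) =
      X * derivative (CHPoly τ k) - C (k : ℝ) * CHPoly τ k
  | 0 => by simp [CHPoly]
  | 1 => by simp [CHPoly]
  | (k+2) => by
    rw [CHPoly_derivative_succ τ (k+1), derivative_C_mul, CHPoly_derivative_succ τ k, CHPoly]
    simp only [Nat.cast_add, Nat.cast_one, Nat.cast_ofNat, map_add, map_mul, map_one, map_ofNat,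
      map_natCast]
    ring

theorem integrable_eval_mul_exp_neg_mul_sq {b : ℝ} (hb : 0 < b) (p : ℝ[X]) :
    Integrable fun x : ℝ => p.eval x * Real.exp (-b * x ^ 2) := by
  induction p using Polynomial.induction_on' with
  | add p q hp hq => simpa only [eval_add, add_mul] using hp.fun_add hq
  | monomial n c =>
    have h := integrable_rpow_mul_exp_neg_mul_sq hb
      (s := (n : ℝ)) (neg_one_lt_zero.trans_le n.cast_nonneg)
    simpa only [eval_monomial, Real.rpow_natCast, mul_assoc] using h.const_mul c

theorem integrable_exp_mul_eval_mul_gaussian {a : ℝ} (ha : 0 < a) (t : ℝ) (p : ℝ[X]) :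
    Integrable fun x : ℝ => Real.exp (t * x) * p.eval x * Real.exp (-x ^ 2 / a) := by
  have h := ((integrable_eval_mul_exp_neg_mul_sq (inv_pos.2 ha)
    (p.comp (X + C (a * t / 2)))).comp_sub_right (a * t / 2)).const_mul (Real.exp (a * t ^ 2 / 4))
  refine h.congr (.of_forall fun x => ?_)
  have he : Real.exp (a * t ^ 2 / 4) * Real.exp (-a⁻¹ * (x - a * t / 2) ^ 2) =
      Real.exp (t * x) * Real.exp (-x ^ 2 / a) := by
    rw [← Real.exp_add, ← Real.exp_add]
    congr 1
    field_simp
    ring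
  simp only [eval_comp, eval_add, eval_X, eval_C, sub_add_cancel]
  linear_combination p.eval x * he

theorem integral_exp_mul_derivative_mul_gaussian {a : ℝ} (ha : 0 < a) (t : ℝ) (q : ℝ[X]) :
    ∫ x : ℝ, Real.exp (t * x) * (derivative q + (C t - C (2 / a) * X) * q).eval x *
      Real.exp (-x ^ 2 / a) = 0 := by
  refine integral_eq_zero_of_hasDerivAt_of_integrable (fun x => ?_)
    (integrable_exp_mul_eval_mul_gaussian ha t _) (integrable_exp_mul_eval_mul_gaussian ha t q)
  have h1 : HasDerivAt (fun x : ℝ => Real.exp (t * x)) (Real.exp (t * x) * (t * 1)) x :=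
    ((hasDerivAt_id x).const_mul t).exp
  have h2 : HasDerivAt (fun x : ℝ => Real.exp (-x ^ 2 / a))
      (Real.exp (-x ^ 2 / a) * (-(2 * x) / a)) x := by
    simpa using ((hasDerivAt_pow 2 x).fun_neg.div_const a).exp
  refine ((h1.mul (q.hasDerivAt x)).mul h2).congr_deriv ?_
  simp only [eval_add, eval_mul, eval_sub, eval_C, eval_X, Pi.mul_apply]
  ring

theorem iteratedDeriv_integral_exp_mul_gaussian {a : ℝ} (ha : 0 < a) (p : ℝ[X]) (n : ℕ) (t : ℝ) :
    iteratedDeriv n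
      (fun t : ℝ => ∫ x : ℝ, Real.exp (t * x) * p.eval x ^ 2 * Real.exp (-x ^ 2 / a)) t =
      ∫ x : ℝ, Real.exp (t * x) * (X ^ n * p ^ 2).eval x * Real.exp (-x ^ 2 / a) := by
  let f : ℝ → ENNReal := fun x => ENNReal.ofReal (p.eval x ^ 2 * Real.exp (-x ^ 2 / a))
  have hf : Measurable f := by fun_prop
  have hlt : ∀ᵐ x, f x < ⊤ := .of_forall fun x => ENNReal.ofReal_lt_top
  have hreal (x : ℝ) : (f x).toReal = p.eval x ^ 2 * Real.exp (-x ^ 2 / a) :=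
    ENNReal.toReal_ofReal (by positivity)
  have hset : ProbabilityTheory.integrableExpSet id (volume.withDensity f) = Set.univ := by
    refine Set.eq_univ_of_forall fun s => ?_
    refine (integrable_withDensity_iff_integrable_smul' hf hlt).2 ?_
    refine (integrable_exp_mul_eval_mul_gaussian ha s (p ^ 2)).congr (.of_forall fun x => ?_)
    simp only [hreal, smul_eq_mul, id, eval_pow]
    ring
  have hmgf : (fun t : ℝ => ∫ x : ℝ, Real.exp (t * x) * p.eval x ^ 2 * Real.exp (-x ^ 2 / a)) =
      ProbabilityTheory.mgf id (volume.withDensity f) := by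
    funext s
    rw [ProbabilityTheory.mgf, integral_withDensity_eq_integral_toReal_smul hf hlt]
    refine integral_congr_ae (.of_forall fun x => ?_)
    simp only [hreal, smul_eq_mul, id]
    ring
  rw [hmgf, ProbabilityTheory.iteratedDeriv_mgf (by simp [hset]),
    integral_withDensity_eq_integral_toReal_smul hf hlt]
  refine integral_congr_ae (.of_forall fun x => ?_)
  simp only [hreal, smul_eq_mul, id, eval_mul, eval_pow, eval_X]
  ring

theorem iteratedDeriv_sigmaF {τ : ℝ} (hτ : 0 < 1 + τ) (N n : ℕ) (t : ℝ) :
    iteratedDeriv n (sigmaF τ N) t =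
      ∫ x : ℝ, Real.exp (t * x) * (X ^ n * CHPoly τ (N - 1) ^ 2).eval x *
        Real.exp (-x ^ 2 / (1 + τ)) := by
  rw [← iteratedDeriv_integral_exp_mul_gaussian hτ]
  congr 1
  funext s
  simp only [sigmaF, CHPoly_eval]

/-- The polynomial factor of an antiderivative of the integrand of the third-order equation. -/
noncomputable def sigmaPrimitive (τ t m : ℝ) (p : ℝ[X]) : ℝ[X] :=
  -((C (τ * (1 + τ) * t) + C (1 - τ) * X) * (C (τ * (1 + τ) * t) + 2 * X) +
      C (2 * (1 + τ) * τ + 2 * m * τ * (1 + τ) ^ 2)) * p ^ 2 +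
    C τ * (C (2 * (1 + τ) ^ 2 * τ * t) + C (4 * (1 + τ)) * X) * (p * derivative p) -
    C (2 * (1 + τ) ^ 2 * τ ^ 2) * derivative p ^ 2

theorem sigmaPrimitive_eval {τ : ℝ} (hτ : 1 + τ ≠ 0) (t m : ℝ) {p : ℝ[X]}
    (hp : C τ * derivative (derivative p) = X * derivative p - C m * p) (x : ℝ) :
    (derivative (sigmaPrimitive τ t m p) +
      (C t - C (2 / (1 + τ)) * X) * sigmaPrimitive τ t m p).eval x =
    (4 * (1 - τ) / (1 + τ) * x ^ 3 - 2 * (1 - 4 * τ + τ ^ 2) * t * x ^ 2 -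
      (3 * τ * (1 - τ ^ 2) * t ^ 2 + 4 * (m * (1 - τ ^ 2) + 1 - 2 * τ)) * x -
      (τ ^ 2 * (1 + τ) * t ^ 2 + 4 * m * τ * (1 + τ) + τ * (5 - τ)) * (1 + τ) * t) *
      p.eval x ^ 2 := by
  have h := congrArg (eval x) hp
  simp only [eval_mul, eval_sub, eval_C, eval_X] at h
  simp only [sigmaPrimitive, derivative_add, derivative_sub, derivative_neg, derivative_mul,
    derivative_pow, derivative_C, derivative_X, derivative_ofNat, eval_add, eval_sub, eval_neg,
    eval_mul, eval_pow, eval_C, eval_X, eval_ofNat, eval_one, eval_zero]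
  generalize eval x (derivative (derivative p)) = c2 at *
  generalize eval x (derivative p) = c1 at *
  generalize eval x p = c0 at *
  field_simp
  push_cast
  linear_combination (1 + τ) * ((2 * (1 + τ) ^ 2 * τ * t + 4 * (1 + τ) * x) * c0 -
    4 * (1 + τ) ^ 2 * τ * c1) * h

/-- **Theorem (Third-order differential equation for `σ`).** -/
theorem sigma_third_order_ODE (τ : ℝ) (hτ : τ ∈ Set.Icc (0:ℝ) 1)
    (N : ℕ) (hNeven : Even N) (hN2 : 2 ≤ N) (t : ℝ) :
    (4*(1-τ)/(1+τ)) * iteratedDeriv 3 (sigmaF τ N) t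
      = 2*(1-4*τ+τ^2) * t * iteratedDeriv 2 (sigmaF τ N) t
        + (3*τ*(1-τ^2)*t^2 + 4*(((N:ℝ)-1)*(1-τ^2) + 1-2*τ)) * deriv (sigmaF τ N) t
        + (τ^2*(1+τ)*t^2 + 4*((N:ℝ)-1)*τ*(1+τ) + τ*(5-τ)) * (1+τ) * t * sigmaF τ N t := by
  have ha : 0 < 1 + τ := by linarith [hτ.1]
  have hm : ((N - 1 : ℕ) : ℝ) = (N : ℝ) - 1 := by
    rw [Nat.cast_sub (by omega), Nat.cast_one]
  have hode := CHPoly_hermite_ode τ (N - 1)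
  rw [hm] at hode
  have h := integral_exp_mul_derivative_mul_gaussian ha t
    (sigmaPrimitive τ t ((N : ℝ) - 1) (CHPoly τ (N - 1)))
  simp only [sigmaPrimitive_eval ha.ne' t _ hode] at h
  rw [← iteratedDeriv_one, ← congrFun (iteratedDeriv_zero (f := sigmaF τ N)) t]
  simp only [iteratedDeriv_sigmaF ha]
  have hi (n : ℕ) (c : ℝ) :=
    (integrable_exp_mul_eval_mul_gaussian ha t (X ^ n * CHPoly τ (N - 1) ^ 2)).const_mul c
  rw [← sub_eq_zero, ← h]
  simp only [← integral_const_mul]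
  rw [← integral_add (hi 2 _) (hi 1 _), ← integral_add ((hi 2 _).fun_add (hi 1 _)) (hi 0 _),
    ← integral_sub (hi 3 _) (((hi 2 _).fun_add (hi 1 _)).fun_add (hi 0 _))]
  refine integral_congr_ae (.of_forall fun x => ?_)
  simp only [eval_mul, eval_pow, eval_X]
  ring
end
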